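/- arXiv:1909.00108 — 6 statements merged into one kernel-verified Lean document; each statement's English description precedes it below -/
import Mathlib

section
/- G_{2,2} = 𝒢_{2,2}; that is, a matrix [[a,b],[c,d]] ∈ SL₂(ℤ) lies in the subgroup generated by L₂ and R₂ if and only if a ≡ 1 (mod 4), d ≡ 1 (mod 4), and b and c are even. -/
open Matrix

abbrev SL2Z : Type := Matrix.SpecialLinearGroup (Fin 2) ℤ

/-- The matrix `L_u = [[1,0],[u,1]]` as an element of `SL₂(ℤ)`. -/
def Lmat (u : ℤ) : SL2Z := ⟨!![1, 0; u, 1], by simp [Matrix.det_fin_two_of]⟩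

/-- The matrix `R_v = [[1,v],[0,1]]` as an element of `SL₂(ℤ)`. -/
def Rmat (v : ℤ) : SL2Z := ⟨!![1, v; 0, 1], by simp [Matrix.det_fin_two_of]⟩

/-- `S_{u,v}`: the submonoid of `SL₂(ℤ)` generated by `L_u` and `R_v`. -/
def Smonoid (u v : ℤ) : Submonoid SL2Z := Submonoid.closure {Lmat u, Rmat v}

/-- `G_{u,v}`: the subgroup of `SL₂(ℤ)` generated by `L_u` and `R_v`. -/
def Ggroup (u v : ℤ) : Subgroup SL2Z := Subgroup.closure {Lmat u, Rmat v}

/-- `𝒮_{u,v}`. -/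
def scrS (u v : ℤ) : Set SL2Z :=
  {M | 0 ≤ M.1 0 0 ∧ 0 ≤ M.1 0 1 ∧ 0 ≤ M.1 1 0 ∧ 0 ≤ M.1 1 1 ∧
    M.1 0 0 ≡ 1 [ZMOD (u * v)] ∧ M.1 1 1 ≡ 1 [ZMOD (u * v)] ∧
    v ∣ M.1 0 1 ∧ u ∣ M.1 1 0}

/-- `𝒢_{u,v}`. -/
def scrG (u v : ℤ) : Set SL2Z :=
  {M | M.1 0 0 ≡ 1 [ZMOD (u * v)] ∧ M.1 1 1 ≡ 1 [ZMOD (u * v)] ∧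
    v ∣ M.1 0 1 ∧ u ∣ M.1 1 0}

lemma SL2Z_mul_apply (A B : SL2Z) (i j : Fin 2) :
    (A * B).1 i j = A.1 i 0 * B.1 0 j + A.1 i 1 * B.1 1 j :=
  (Matrix.mul_apply (M := A.1) (N := B.1)).trans (Fin.sum_univ_two _)

lemma SL2Z_inv_val (A : SL2Z) :
    (A⁻¹).1 = !![A.1 1 1, -A.1 0 1; -A.1 1 0, A.1 0 0] :=
  Matrix.adjugate_fin_two A.1

lemma Lmat_mul_apply_zero (x : ℤ) (M : SL2Z) (j : Fin 2) : (Lmat x * M).1 0 j = M.1 0 j := by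
  rw [SL2Z_mul_apply]
  simp [Lmat]

lemma Lmat_mul_apply_one (x : ℤ) (M : SL2Z) (j : Fin 2) :
    (Lmat x * M).1 1 j = M.1 1 j + x * M.1 0 j := by
  rw [SL2Z_mul_apply]
  simp [Lmat, add_comm]

lemma Rmat_mul_apply_zero (x : ℤ) (M : SL2Z) (j : Fin 2) :
    (Rmat x * M).1 0 j = M.1 0 j + x * M.1 1 j := by
  rw [SL2Z_mul_apply]
  simp [Rmat]

lemma Rmat_mul_apply_one (x : ℤ) (M : SL2Z) (j : Fin 2) : (Rmat x * M).1 1 j = M.1 1 j := by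
  rw [SL2Z_mul_apply]
  simp [Rmat]

/-- The set `𝒢_{u,v}` as a subgroup of `SL₂(ℤ)`. -/
def scrGSubgroup (u v : ℤ) : Subgroup SL2Z where
  carrier := scrG u v
  one_mem' := by simp [scrG]
  mul_mem' := by
    rintro A B ⟨hA₁, hA₂, ⟨b, hb⟩, ⟨c, hc⟩⟩ ⟨hB₁, hB₂, ⟨y, hy⟩, ⟨z, hz⟩⟩
    refine ⟨?_, ?_, ?_, ?_⟩ <;> rw [SL2Z_mul_apply]
    · have h : A.1 0 1 * B.1 1 0 ≡ 0 [ZMOD u * v] :=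
        Int.modEq_zero_iff_dvd.2 ⟨b * z, by rw [hb, hz]; ring⟩
      simpa using (hA₁.mul hB₁).add h
    · have h : A.1 1 0 * B.1 0 1 ≡ 0 [ZMOD u * v] :=
        Int.modEq_zero_iff_dvd.2 ⟨c * y, by rw [hc, hy]; ring⟩
      simpa using h.add (hA₂.mul hB₂)
    · exact dvd_add (Dvd.intro _ (by rw [hy]; ring : v * (A.1 0 0 * y) = _))
        (Dvd.intro _ (by rw [hb]; ring : v * (b * B.1 1 1) = _))
    · exact dvd_add (Dvd.intro _ (by rw [hc]; ring : u * (c * B.1 0 0) = _))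
        (Dvd.intro _ (by rw [hz]; ring : u * (A.1 1 1 * z) = _))
  inv_mem' := by
    rintro A ⟨h₁, h₂, hb, hc⟩
    refine ⟨?_, ?_, ?_, ?_⟩ <;> rw [SL2Z_inv_val] <;> simpa

lemma Ggroup_le_scrGSubgroup (u v : ℤ) : Ggroup u v ≤ scrGSubgroup u v := by
  refine (Subgroup.closure_le _).2 ?_
  rintro M (rfl | rfl)
  · exact ⟨by simp [Lmat], by simp [Lmat], by simp [Lmat], by simp [Lmat]⟩
  · exact ⟨by simp [Rmat], by simp [Rmat], by simp [Rmat], by simp [Rmat]⟩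

lemma Lmat_add (x y : ℤ) : Lmat (x + y) = Lmat x * Lmat y := by
  ext i j
  fin_cases i
  · exact .trans (by fin_cases j <;> simp [Lmat]) (Lmat_mul_apply_zero x _ j).symm
  · exact .trans (by fin_cases j <;> simp [Lmat, add_comm]) (Lmat_mul_apply_one x _ j).symm

lemma Rmat_add (x y : ℤ) : Rmat (x + y) = Rmat x * Rmat y := by
  ext i j
  fin_cases i
  · exact .trans (by fin_cases j <;> simp [Rmat, add_comm]) (Rmat_mul_apply_zero x _ j).symm
  · exact .trans (by fin_cases j <;> simp [Rmat]) (Rmat_mul_apply_one x _ j).symm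

lemma Lmat_mul_mem_Ggroup (u v k : ℤ) : Lmat (u * k) ∈ Ggroup u v := by
  have hL : Lmat u ∈ Ggroup u v := Subgroup.subset_closure (by simp)
  induction k with
  | zero =>
    convert (Ggroup u v).one_mem
    ext i j
    fin_cases i <;> fin_cases j <;> simp [Lmat]
  | succ n ih =>
    rw [mul_add, mul_one, Lmat_add]
    exact mul_mem ih hL
  | pred n ih =>
    refine ((Ggroup u v).mul_mem_cancel_right hL).1 ?_
    rwa [← Lmat_add, mul_sub, mul_one, sub_add_cancel]

lemma Rmat_mul_mem_Ggroup (u v k : ℤ) : Rmat (v * k) ∈ Ggroup u v := by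
  have hR : Rmat v ∈ Ggroup u v := Subgroup.subset_closure (by simp)
  induction k with
  | zero =>
    convert (Ggroup u v).one_mem
    ext i j
    fin_cases i <;> fin_cases j <;> simp [Rmat]
  | succ n ih =>
    rw [mul_add, mul_one, Rmat_add]
    exact mul_mem ih hR
  | pred n ih =>
    refine ((Ggroup u v).mul_mem_cancel_right hR).1 ?_
    rwa [← Rmat_add, mul_sub, mul_one, sub_add_cancel]

/-- Subtracting or adding twice a nonzero integer of smaller absolute value decreases the
absolute value. -/
lemma exists_natAbs_add_two_mul_lt {x y : ℤ} (hy : y ≠ 0) (h : y.natAbs < x.natAbs) :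
    ∃ k : ℤ, (x + 2 * k * y).natAbs < x.natAbs := by
  by_cases hs : 0 < x ↔ 0 < y
  · exact ⟨-1, by omega⟩
  · exact ⟨1, by omega⟩

lemma mem_Ggroup_of_mem_scrG (M : SL2Z) (hM : M ∈ scrG 2 2) : M ∈ Ggroup 2 2 := by
  induction hn : (M.1 0 0).natAbs + (M.1 1 0).natAbs using Nat.strong_induction_on
    generalizing M with
  | _ n ih =>
  subst hn
  have step (g : SL2Z) (hg : g ∈ Ggroup 2 2)
      (hlt : ((g * M).1 0 0).natAbs + ((g * M).1 1 0).natAbs <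
        (M.1 0 0).natAbs + (M.1 1 0).natAbs) : M ∈ Ggroup 2 2 :=
    ((Ggroup 2 2).mul_mem_cancel_left hg).1 <|
      ih _ hlt _ ((scrGSubgroup 2 2).mul_mem (Ggroup_le_scrGSubgroup 2 2 hg) hM) rfl
  obtain ⟨ha, hd, hb, hc⟩ := hM
  have hdet := M.2
  rw [Matrix.det_fin_two] at hdet
  simp only [Int.ModEq] at ha hd
  by_cases hc0 : M.1 1 0 = 0
  · rw [hc0, mul_zero, sub_zero] at hdet
    have ha1 : M.1 0 0 = 1 := by
      rcases Int.eq_one_or_neg_one_of_mul_eq_one hdet with h | h <;> omega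
    have hd1 : M.1 1 1 = 1 := by simpa [ha1] using hdet
    obtain ⟨k, hk⟩ := hb
    convert Rmat_mul_mem_Ggroup 2 2 k
    ext i j
    fin_cases i <;> fin_cases j <;> simp [Rmat, ha1, hd1, hk, hc0]
  · rcases lt_or_gt_of_ne (show (M.1 1 0).natAbs ≠ (M.1 0 0).natAbs by omega) with h | h
    · obtain ⟨k, hk⟩ := exists_natAbs_add_two_mul_lt hc0 h
      exact step _ (Rmat_mul_mem_Ggroup 2 2 k)
        (by simpa [Rmat_mul_apply_zero, Rmat_mul_apply_one] using hk)
    · obtain ⟨k, hk⟩ := exists_natAbs_add_two_mul_lt (by omega) h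
      exact step _ (Lmat_mul_mem_Ggroup 2 2 k)
        (by simpa [Lmat_mul_apply_zero, Lmat_mul_apply_one] using hk)

/-- Sanov: `G_{2,2} = 𝒢_{2,2}`; that is, a matrix in `SL₂(ℤ)` lies
in the subgroup generated by `L₂` and `R₂` if and only if `a ≡ 1 (mod 4)`,
`d ≡ 1 (mod 4)`, and `b` and `c` are even. -/
theorem sanov : ∀ M : SL2Z, M ∈ Ggroup 2 2 ↔ M ∈ scrG 2 2 :=
  fun M => ⟨fun h => Ggroup_le_scrGSubgroup 2 2 h, mem_Ggroup_of_mem_scrG M⟩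
end

section
/- Let [q₀,…,q_r] ∈ A₁ with r ≥ 2 and suppose q_j = 1 for some index 0 < j < r. Then the list [q₀,…,q_{j−1}+1, −(q_{j+1}+1), −q_{j+2},…,−q_r] has a well-defined continued fraction value and E([q₀,…,q_{j−1},1,q_{j+1},…,q_r]) = E([q₀,…,q_{j−1}+1, −(q_{j+1}+1), −q_{j+2},…,−q_r]). -/
/-- Continued fraction value of a list of integers (junk value `0` on `[]`,
division by zero yields junk, as usual in Lean). -/
def E : List ℤ → ℚ
  | [] => 0
  | [q] => (q : ℚ)
  | q :: l => (q : ℚ) + 1 / E l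

/-- The continued fraction value of the list is well defined: the list is
nonempty and no division by zero occurs in the evaluation of `E`. -/
def EWellDef : List ℤ → Prop
  | [] => False
  | [_] => True
  | _ :: l => EWellDef l ∧ E l ≠ 0

/-- Membership in `A₀`: `[q₀,…,q_r]` with `q_i ≠ 0` for `1 ≤ i ≤ r` and
`E([q_i,…,q_r]) ≠ 0` for `0 < i < r`. -/
def memA0 (l : List ℤ) : Prop :=
  l ≠ [] ∧ (∀ i, 0 < i → i < l.length → l.getD i 0 ≠ 0) ∧
    ∀ i, 0 < i → i + 1 < l.length → E (l.drop i) ≠ 0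

/-- Membership in `A₁`: member of `A₀` with `q_i ≥ 1` for `0 < i < r` and
`q_r > 1` when `r > 0`. -/
def memA1 (l : List ℤ) : Prop :=
  memA0 l ∧ (∀ i, 0 < i → i + 1 < l.length → 1 ≤ l.getD i 0) ∧
    (1 < l.length → 1 < l.getD (l.length - 1) 0)

/-- Membership in `A₂`: member of `A₀` with `|q_i| > 1` for `0 < i ≤ r`. -/
def memA2 (l : List ℤ) : Prop :=
  memA0 l ∧ ∀ i, 0 < i → i < l.length → 1 < |l.getD i 0|

/-- Euclidean-algorithm computation of the short continued fraction of `a/b`. -/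
def scfAux (a : ℤ) (b : ℕ) : List ℤ :=
  if hb : b = 0 then []
  else
    have h0 : 0 ≤ Int.emod a (b : ℤ) := Int.emod_nonneg a (by exact_mod_cast hb)
    have h1 : Int.emod a (b : ℤ) < (b : ℤ) :=
      Int.emod_lt_of_pos a (by exact_mod_cast Nat.pos_of_ne_zero hb)
    if hr : (Int.emod a (b : ℤ)).toNat = 0 then [Int.ediv a (b : ℤ)]
    else Int.ediv a (b : ℤ) :: scfAux (b : ℤ) (Int.emod a (b : ℤ)).toNat
  termination_by b
  decreasing_by omega

/-- `C x` is the short continued fraction representation of the rational `x`,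
i.e. the unique list in `A₁` whose continued fraction value is `x`. -/
def C (x : ℚ) : List ℤ := scfAux x.num x.den

/-- Entrywise negation of a list. -/
def negL (l : List ℤ) : List ℤ := l.map (fun q => -q)

/-- The operation `⊕` on lists. -/
def oplus (a b : List ℤ) : List ℤ :=
  match b with
  | [] => a
  | p :: ps =>
    if p = 0 then a.dropLast ++ (a.getLastD 0 + ps.headD 0) :: ps.tail
    else a ++ (p :: ps)

/-- The function `f : A₁ → A₂`. -/
def f (l : List ℤ) : List ℤ :=
  if h : (l.tail.dropLast).findIdx (fun q => q == 1) < l.tail.dropLast.length then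
    let j := (l.tail.dropLast).findIdx (fun q => q == 1) + 1
    oplus (l.take (j - 1) ++ [l.getD (j - 1) 0 + 1])
      (negL (f ((l.getD (j + 1) 0 + 1) :: l.drop (j + 2))))
  else l
  termination_by l.length
  decreasing_by
    simp only [List.length_dropLast, List.length_tail, List.length_cons,
      List.length_drop] at h ⊢
    omega

/-- The function `g : A₂ → A₁`. -/
def g (l : List ℤ) : List ℤ :=
  if h : (l.tail).findIdx (fun q => decide (q < 0)) < l.tail.length then
    let j := (l.tail).findIdx (fun q => decide (q < 0)) + 1
    oplus (l.take (j - 1) ++ [l.getD (j - 1) 0 - 1, 1])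
      (g (negL ((l.getD j 0 + 1) :: l.drop (j + 1))))
  else l
  termination_by l.length
  decreasing_by
    simp only [negL, List.length_map, List.length_cons, List.length_drop,
      List.length_tail] at h ⊢
    omega

/-- `[q₀,…,q_r]` satisfies the `(u,v)`-divisibility property: `v ∣ q_i` for even
`i` and `u ∣ q_i` for odd `i`. -/
def DivProp (u v : ℤ) (l : List ℤ) : Prop :=
  ∀ i, i < l.length → (i % 2 = 0 → v ∣ l.getD i 0) ∧ (i % 2 = 1 → u ∣ l.getD i 0)

theorem E_cons (q : ℤ) {l : List ℤ} (hl : l ≠ []) : E (q :: l) = q + 1 / E l := by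
  cases l with
  | nil => exact absurd rfl hl
  | cons a s => rfl

theorem EWellDef_cons (q : ℤ) {l : List ℤ} (hl : l ≠ []) :
    EWellDef (q :: l) ↔ EWellDef l ∧ E l ≠ 0 := by
  cases l with
  | nil => exact absurd rfl hl
  | cons a s => rfl

theorem E_pos {l : List ℤ} (hl : l ≠ []) (h : ∀ x ∈ l, 1 ≤ x) : 0 < E l := by
  induction l with
  | nil => exact absurd rfl hl
  | cons q s ih =>
    have hq : (0 : ℚ) < q := by
      exact_mod_cast Int.lt_of_lt_of_le one_pos (h q List.mem_cons_self)
    rcases eq_or_ne s [] with rfl | hs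
    · exact hq
    · have := ih hs fun x hx => h x (List.mem_cons_of_mem q hx)
      rw [E_cons q hs]
      positivity

theorem EWellDef_of_one_le_tail {l : List ℤ} (hl : l ≠ []) (h : ∀ x ∈ l.tail, 1 ≤ x) :
    EWellDef l := by
  induction l with
  | nil => exact absurd rfl hl
  | cons q s ih =>
    rcases eq_or_ne s [] with rfl | hs
    · trivial
    · exact (EWellDef_cons q hs).2
        ⟨ih hs fun x hx => h x (List.mem_of_mem_tail hx), (E_pos hs h).ne'⟩

theorem E_negL (l : List ℤ) : E (negL l) = -E l := by
  induction l with
  | nil => simp [negL, E]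
  | cons q s ih =>
    rcases eq_or_ne s [] with rfl | hs
    · simp [negL, E]
    · have hs' : negL s ≠ [] := by simpa [negL] using hs
      change E (-q :: negL s) = _
      rw [E_cons _ hs', E_cons _ hs, ih]
      push_cast
      rw [one_div_neg_eq_neg_one_div]
      ring

theorem EWellDef_negL {l : List ℤ} (h : EWellDef l) : EWellDef (negL l) := by
  induction l with
  | nil => exact h
  | cons q s ih =>
    rcases eq_or_ne s [] with rfl | hs
    · trivial
    · have hs' : negL s ≠ [] := by simpa [negL] using hs
      obtain ⟨hw, h0⟩ := (EWellDef_cons q hs).1 h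
      exact (EWellDef_cons (-q) hs').2 ⟨ih hw, by rwa [E_negL, neg_ne_zero]⟩

theorem E_add_one_cons (b : ℤ) (s : List ℤ) : E ((b + 1) :: s) = E (b :: s) + 1 := by
  rcases eq_or_ne s [] with rfl | hs
  · simp [E]
  · rw [E_cons _ hs, E_cons _ hs]
    push_cast
    ring

/-- Replacing a suffix by one of equal, well-defined value preserves the value
when the entries of the original list after the first are positive. -/
theorem EWellDef_and_E_append_congr (p : List ℤ) {u v : List ℤ} (hu : u ≠ []) (hv : v ≠ [])
    (h : ∀ x ∈ (p ++ u).tail, 1 ≤ x) (huv : E u = E v) (hw : EWellDef v) :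
    EWellDef (p ++ v) ∧ E (p ++ u) = E (p ++ v) := by
  induction p with
  | nil => exact ⟨hw, huv⟩
  | cons q p ih =>
    have hpu : p ++ u ≠ [] := by simp [hu]
    have hpv : p ++ v ≠ [] := by simp [hv]
    obtain ⟨ihw, ihE⟩ := ih fun x hx => h x (List.mem_of_mem_tail hx)
    have hpos : 0 < E (p ++ u) := E_pos hpu h
    simp only [List.cons_append]
    rw [EWellDef_cons q hpv, E_cons q hpu, E_cons q hpv, ← ihE]
    exact ⟨⟨ihw, hpos.ne'⟩, rfl⟩

theorem EWellDef_and_E_one_cons (a b : ℤ) (s : List ℤ) (h : ∀ x ∈ b :: s, 1 ≤ x) :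
    EWellDef ((a + 1) :: negL ((b + 1) :: s)) ∧
      E (a :: 1 :: b :: s) = E ((a + 1) :: negL ((b + 1) :: s)) := by
  have hy : 0 < E (b :: s) := E_pos (List.cons_ne_nil _ _) h
  have hn : negL ((b + 1) :: s) ≠ [] := by simp [negL]
  rw [EWellDef_cons _ hn, E_cons _ hn, E_negL, E_add_one_cons,
    E_cons a (List.cons_ne_nil _ _), E_cons 1 (List.cons_ne_nil _ _)]
  refine ⟨⟨EWellDef_negL (EWellDef_of_one_le_tail (List.cons_ne_nil _ _)
    fun x hx => h x (List.mem_cons_of_mem b hx)), by linarith⟩, ?_⟩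
  generalize E (b :: s) = y at hy
  have h1 : y + 1 ≠ 0 := by positivity
  have h2 : 1 + 1 / y = (y + 1) / y := by field_simp
  push_cast
  rw [h2, one_div_neg_eq_neg_one_div]
  field_simp
  ring

theorem one_le_of_mem_tail_of_memA1 {l : List ℤ} (hl : memA1 l) : ∀ x ∈ l.tail, 1 ≤ x := by
  intro x hx
  obtain ⟨i, hi, rfl⟩ := List.getElem_of_mem hx
  rw [List.length_tail] at hi
  have hi' : i + 1 < l.length := by omega
  rw [List.getElem_tail, ← List.getD_eq_getElem l 0 hi']
  rcases Nat.lt_or_ge (i + 1 + 1) l.length with h | h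
  · exact hl.2.1 (i + 1) i.succ_pos h
  · have := hl.2.2 (by omega)
    rw [show l.length - 1 = i + 1 by omega] at this
    exact this.le

/-- Lemma tran: if `[q₀,…,q_r] ∈ A₁` with `q_j = 1` for some
`0 < j < r`, then `[q₀,…,q_{j−1}+1, −(q_{j+1}+1), −q_{j+2},…,−q_r]` has a
well-defined continued fraction value, equal to `E([q₀,…,q_r])`. -/
theorem tran (l : List ℤ) (hl : memA1 l) (j : ℕ) (hj0 : 0 < j)
    (hjr : j + 1 < l.length) (hq : l.getD j 0 = 1) :
    EWellDef (l.take (j - 1) ++ [l.getD (j - 1) 0 + 1] ++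
        negL ((l.getD (j + 1) 0 + 1) :: l.drop (j + 2))) ∧
      E l = E (l.take (j - 1) ++ [l.getD (j - 1) 0 + 1] ++
        negL ((l.getD (j + 1) 0 + 1) :: l.drop (j + 2))) := by
  obtain ⟨k, rfl⟩ : ∃ k, j = k + 1 := ⟨j - 1, by omega⟩
  have hdecomp : l = l.take k ++ l.getD k 0 :: 1 :: l.getD (k + 2) 0 :: l.drop (k + 3) := by
    conv_lhs => rw [← List.take_append_drop k l]
    rw [← hq, List.getD_eq_getElem l 0 (by omega : k < l.length),
      List.getD_eq_getElem l 0 (by omega : k + 1 < l.length),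
      List.getD_eq_getElem l 0 hjr, ← List.drop_eq_getElem_cons,
      ← List.drop_eq_getElem_cons, ← List.drop_eq_getElem_cons]
  have htail := one_le_of_mem_tail_of_memA1 hl
  simp only [Nat.add_sub_cancel, List.append_assoc, List.singleton_append]
  change EWellDef (_ ++ (l.getD k 0 + 1) :: negL ((l.getD (k + 2) 0 + 1) :: l.drop (k + 3))) ∧
    E l = E (_ ++ (l.getD k 0 + 1) :: negL ((l.getD (k + 2) 0 + 1) :: l.drop (k + 3)))
  generalize l.take k = p, l.getD k 0 = a, l.getD (k + 2) 0 = b, l.drop (k + 3) = s at hdecomp ⊢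
  rw [hdecomp] at htail ⊢
  have hbs : ∀ x ∈ b :: s, 1 ≤ x := fun x hx => htail x <| by
    cases p <;> simp_all
  obtain ⟨hw, hE⟩ := EWellDef_and_E_one_cons a b s hbs
  exact EWellDef_and_E_append_congr p (List.cons_ne_nil _ _) (List.cons_ne_nil _ _) htail hE hw
end

section
/- Let [q₀,q₁,…,q_r] ∈ A₂ and write g([q₀,q₁,…,q_r]) = [q′₀,q′₁,…,q′_s]. Then for every integer n, g([q₀+n,q₁,…,q_r]) = [q′₀+n,q′₁,…,q′_s]. -/
theorem oplus_cons_of_ne_nil (a : ℤ) {w : List ℤ} (hw : w ≠ []) (b : List ℤ) :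
    oplus (a :: w) b = a :: oplus w b := by
  obtain ⟨x, xs, rfl⟩ := List.exists_cons_of_ne_nil hw
  cases b with
  | nil => rfl
  | cons p ps => by_cases hp : p = 0 <;> simp [oplus, hp]

/-- Up to the head, `g (a :: t)` depends only on `t`: the head is shifted by a constant
and the tail does not depend on `a`. -/
theorem exists_g_cons_eq (t : List ℤ) :
    ∃ (c : ℤ) (u : List ℤ), ∀ a : ℤ, g (a :: t) = (a + c) :: u := by
  by_cases h : t.findIdx (fun q => decide (q < 0)) < t.length
  · cases hk : t.findIdx (fun q => decide (q < 0)) with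
    | zero =>
      rw [hk] at h
      refine ⟨-1, oplus [1] (g (negL ((t.getD 0 0 + 1) :: t.drop 1))), fun a => ?_⟩
      rw [g]
      simp [hk, h, oplus_cons_of_ne_nil, sub_eq_add_neg]
    | succ k =>
      rw [hk] at h
      refine ⟨0, oplus (t.take k ++ [t.getD k 0 - 1, 1])
        (g (negL ((t.getD (k + 1) 0 + 1) :: t.drop (k + 2)))), fun a => ?_⟩
      rw [g]
      simp [hk, h, oplus_cons_of_ne_nil]
  · refine ⟨0, t, fun a => ?_⟩
    rw [g]
    rw [dif_neg (by exact h), add_zero]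

/-- let `[q₀,q₁,…,q_r] ∈ A₂` and write
`g([q₀,q₁,…,q_r]) = [q′₀,q′₁,…,q′_s]`. Then for every integer `n`,
`g([q₀+n,q₁,…,q_r]) = [q′₀+n,q′₁,…,q′_s]`. -/
theorem g_head_add (l : List ℤ) (hl : memA2 l) (q' : ℤ) (t' : List ℤ)
    (hg : g l = q' :: t') (n : ℤ) :
    g ((l.headD 0 + n) :: l.tail) = (q' + n) :: t' := by
  obtain ⟨a, t, rfl⟩ := List.exists_cons_of_ne_nil hl.1.1
  obtain ⟨c, u, h⟩ := exists_g_cons_eq t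
  rw [h, List.cons.injEq] at hg
  obtain ⟨rfl, rfl⟩ := hg
  simp only [List.headD_cons, List.tail_cons, h, add_right_comm]
end

section
/- For every list [q₀,…,q_r] ∈ A₂ with |q_i| ≥ 3 for all 0 < i ≤ r, f(g([q₀,…,q_r])) = [q₀,…,q_r]. -/
theorem findIdx_append_cons_of_forall_false {α : Type*} (P : α → Bool) (p : List α) (n : α)
    (s : List α) (hp : ∀ x ∈ p, P x = false) (hn : P n = true) :
    (p ++ n :: s).findIdx P = p.length := by
  induction p with
  | nil => simp [List.findIdx_cons, hn]
  | cons x p ih =>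
    have hx := hp x (by simp)
    simp [List.findIdx_cons, hx, ih fun y hy => hp y (by simp [hy])]

theorem g_of_forall_nonneg (l : List ℤ) (h : ∀ x ∈ l.tail, 0 ≤ x) : g l = l := by
  rw [g, dif_neg]
  rw [List.findIdx_lt_length]
  rintro ⟨x, hx, hneg⟩
  have := h x hx
  simp only [decide_eq_true_eq] at hneg
  omega

theorem f_of_forall_ne_one (l : List ℤ) (h : ∀ x ∈ l.tail, x ≠ 1) : f l = l := by
  rw [f, dif_neg]
  rw [List.findIdx_lt_length]
  rintro ⟨x, hx, hone⟩
  exact h x (List.mem_of_mem_dropLast hx) (by simpa using hone)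

/-- One step of `g` at the first negative entry `n` of the tail. -/
theorem g_append_cons_cons (a : List ℤ) (b n : ℤ) (s : List ℤ)
    (ha : ∀ x ∈ (a ++ [b]).tail, 0 ≤ x) (hn : n < 0) :
    g (a ++ b :: n :: s) = oplus (a ++ [b - 1, 1]) (g (-(n + 1) :: negL s)) := by
  have htail : (a ++ b :: n :: s).tail = (a ++ [b]).tail ++ n :: s := by
    cases a <;> simp
  have hidx : (a ++ b :: n :: s).tail.findIdx (fun q => decide (q < 0)) = a.length := by
    rw [htail, findIdx_append_cons_of_forall_false]
    · simp
    · intro x hx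
      simpa using ha x hx
    · simpa using hn
  rw [g, dif_pos (by rw [hidx]; simp)]
  simp only [hidx]
  have hdrop : (a ++ b :: n :: s).drop (a.length + 1 + 1) = s := by
    simp [List.drop_append, add_assoc]
  rw [hdrop]
  simp [List.getD_eq_getElem?_getD, negL]

/-- One step of `f` at the first interior entry equal to `1`. -/
theorem f_append_cons_one_cons (a : List ℤ) (b c : ℤ) (s : List ℤ)
    (ha : ∀ x ∈ (a ++ [b]).tail, x ≠ 1) :
    f (a ++ b :: 1 :: c :: s) = oplus (a ++ [b + 1]) (negL (f ((c + 1) :: s))) := by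
  have htail : (a ++ b :: 1 :: c :: s).tail.dropLast
      = (a ++ [b]).tail ++ 1 :: (c :: s).dropLast := by
    cases a <;> simp
  have hidx : (a ++ b :: 1 :: c :: s).tail.dropLast.findIdx (fun q => q == 1) = a.length := by
    rw [htail, findIdx_append_cons_of_forall_false]
    · simp
    · intro x hx
      simpa using ha x hx
    · simp
  rw [f, dif_pos (by rw [hidx]; simp)]
  simp only [hidx]
  have hdrop : (a ++ b :: 1 :: c :: s).drop (a.length + 1 + 2) = s := by
    simp [List.drop_append, add_assoc]
  have hget : (a ++ b :: 1 :: c :: s).getD (a.length + 1 + 1) 0 = c := by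
    simp [List.getD_eq_getElem?_getD, add_assoc]
  rw [hdrop, hget]
  simp [List.getD_eq_getElem?_getD]

theorem oplus_cons_of_ne_zero (a : List ℤ) (p : ℤ) (s : List ℤ) (hp : p ≠ 0) :
    oplus a (p :: s) = a ++ p :: s := by
  simp [oplus, hp]

/-- A list of integers either is nonnegative or splits at its first negative entry. -/
theorem forall_nonneg_or_exists_append (t : List ℤ) :
    (∀ x ∈ t, 0 ≤ x) ∨ ∃ p n s, t = p ++ n :: s ∧ (∀ x ∈ p, 0 ≤ x) ∧ n < 0 := by
  induction t with
  | nil => simp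
  | cons y t ih =>
    rcases lt_or_ge y 0 with hy | hy
    · exact .inr ⟨[], y, t, by simp, by simp, hy⟩
    · rcases ih with h | ⟨p, n, s, rfl, hp, hn⟩
      · exact .inl (by simpa [hy] using h)
      · exact .inr ⟨y :: p, n, s, by simp, by simpa [hy] using hp, hn⟩

/-- For a fixed tail, `g` shifts the head by a constant `d ∈ {0, 1}` and produces a tail
independent of the head; `f` undoes this. -/
theorem exists_g_cons_eq_and_f_eq (t : List ℤ) (ht : ∀ x ∈ t, 3 ≤ |x|) :
    ∃ (d : ℤ) (u : List ℤ), d ≤ 1 ∧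
      ∀ x, g (x :: t) = (x - d) :: u ∧ f ((x - d) :: u) = x :: t := by
  induction hk : t.length using Nat.strong_induction_on generalizing t with
  | _ k ih =>
  rcases forall_nonneg_or_exists_append t with h | ⟨p, n, s, rfl, hp, hn⟩
  · refine ⟨0, t, by simp, fun x => ?_⟩
    rw [sub_zero]
    refine ⟨g_of_forall_nonneg _ (by simpa using h), f_of_forall_ne_one _ ?_⟩
    rintro _ hy rfl
    have := ht 1 (by simpa using hy)
    norm_num at this
  · obtain ⟨d, u, hd, hu⟩ := ih s.length (by simp at hk; omega) (negL s) (by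
      intro x hx
      obtain ⟨y, hy, rfl⟩ := List.mem_map.1 hx
      rw [abs_neg]
      exact ht y (by simp [hy])) (by simp [negL])
    have hn3 : n ≤ -3 := by
      have := ht n (by simp)
      rw [abs_of_neg hn] at this
      omega
    have hp3 : ∀ x ∈ p, 3 ≤ x := fun x hx => by
      have := ht x (by simp [hx])
      rwa [abs_of_nonneg (hp x hx)] at this
    have hg (a : List ℤ) (b : ℤ) (ha : ∀ x ∈ (a ++ [b]).tail, 0 ≤ x) :
        g (a ++ b :: n :: s) = a ++ (b - 1) :: 1 :: (-(n + 1) - d) :: u := by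
      rw [g_append_cons_cons a b n s ha hn, (hu _).1, oplus_cons_of_ne_zero _ _ _ (by omega)]
      simp
    have hf (a : List ℤ) (b : ℤ) (ha : ∀ x ∈ (a ++ [b - 1]).tail, x ≠ 1) :
        f (a ++ (b - 1) :: 1 :: (-(n + 1) - d) :: u) = a ++ b :: n :: s := by
      have hhead : -(n + 1) - d + 1 = -n - d := by ring
      have hneg : negL (-n :: negL s) = n :: s := by
        simp [negL]
      rw [f_append_cons_one_cons _ _ _ _ ha, hhead, (hu _).2, hneg,
        oplus_cons_of_ne_zero _ _ _ hn.ne]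
      simp
    rcases List.eq_nil_or_concat' p with rfl | ⟨p, m, rfl⟩
    · exact ⟨1, 1 :: (-(n + 1) - d) :: u, le_rfl, fun x =>
        ⟨by simpa using hg [] x (by simp), by simpa using hf [] x (by simp)⟩⟩
    · refine ⟨0, p ++ (m - 1) :: 1 :: (-(n + 1) - d) :: u, by simp, fun x => ⟨?_, ?_⟩⟩
      · simpa using hg (x :: p) m (by simpa using hp)
      · have hne : ∀ y ∈ ((x :: p) ++ [m - 1]).tail, y ≠ 1 := by
          intro y hy
          simp only [List.cons_append, List.tail_cons, List.mem_append, List.mem_singleton] at hy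
          rcases hy with hy | rfl
          · have := hp3 y (by simp [hy])
            omega
          · have := hp3 m (by simp)
            omega
        simpa using hf (x :: p) m hne

/-- for every list `[q₀,…,q_r] ∈ A₂` with `|q_i| ≥ 3` for all
`0 < i ≤ r`, `f(g([q₀,…,q_r])) = [q₀,…,q_r]`. -/
theorem f_g_eq (l : List ℤ) (hl : memA2 l)
    (h3 : ∀ i, 0 < i → i < l.length → 3 ≤ |l.getD i 0|) :
    f (g l) = l := by
  obtain _ | ⟨x, t⟩ := l
  · exact absurd rfl hl.1.1
  · obtain ⟨d, u, -, h⟩ := exists_g_cons_eq_and_f_eq t (by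
      intro y hy
      obtain ⟨i, hi, rfl⟩ := List.getElem_of_mem hy
      simpa [hi] using h3 (i + 1) (by simp) (by simpa using hi))
    rw [(h x).1, (h x).2]
end

section
/- Let u, v ≥ 2 be integers and let M = [[a,b],[c,d]] ∈ 𝒮_{u,v} (so that a ≥ 1 and d ≥ 1). Then C(c/a) satisfies the (v,u)-divisibility property if and only if C(b/d) satisfies the (u,v)-divisibility property. -/
open Matrix

theorem divProp_nil (u v : ℤ) : DivProp u v [] := by
  intro i hi
  simp at hi

theorem divProp_cons (u v q : ℤ) (l : List ℤ) :
    DivProp u v (q :: l) ↔ v ∣ q ∧ DivProp v u l := by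
  constructor
  · intro h
    refine ⟨by simpa using (h 0 (by simp)).1 rfl, fun i hi => ?_⟩
    have h' := h (i + 1) (by simpa using hi)
    rw [List.getD_cons_succ] at h'
    exact ⟨fun hi => h'.2 (by omega), fun hi => h'.1 (by omega)⟩
  · rintro ⟨hq, h⟩ i hi
    cases i with
    | zero => simpa using hq
    | succ i =>
      have h' := h i (by simpa using hi)
      rw [List.getD_cons_succ]
      exact ⟨fun hi => h'.2 (by omega), fun hi => h'.1 (by omega)⟩

/-- The Euclidean continued fraction of `x / y` has the `(u, v)`-divisibility property. -/
def EuclidDiv (u v x y : ℤ) : Prop := DivProp u v (scfAux x y.toNat)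

theorem euclidDiv_zero (u v x : ℤ) : EuclidDiv u v x 0 := by
  rw [EuclidDiv, scfAux]
  exact divProp_nil u v

theorem euclidDiv_iff (u v x : ℤ) {y : ℤ} (hy : 0 < y) :
    EuclidDiv u v x y ↔ v ∣ x / y ∧ EuclidDiv v u y (x % y) := by
  lift y to ℕ using hy.le
  have hy' : y ≠ 0 := by omega
  unfold EuclidDiv
  rw [Int.toNat_natCast]
  by_cases hr : (x % (y : ℤ)).toNat = 0
  · have h : scfAux x y = [x / (y : ℤ)] := by
      rw [scfAux, dif_neg hy']
      exact dif_pos hr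
    rw [h, hr, divProp_cons, scfAux]
    simp [divProp_nil]
  · have h : scfAux x y = x / (y : ℤ) :: scfAux y (x % (y : ℤ)).toNat := by
      rw [scfAux, dif_neg hy']
      exact dif_neg hr
    rw [h, divProp_cons]

theorem C_div_eq {x y : ℤ} (hy : 0 < y) (h : IsCoprime x y) :
    C ((x : ℚ) / (y : ℚ)) = scfAux x y.toNat := by
  have hc : Nat.Coprime x.natAbs y.natAbs := Int.isCoprime_iff_gcd_eq_one.mp h
  have hden := Rat.den_div_eq_of_coprime hy hc
  rw [C, Rat.num_div_eq_of_coprime hy hc, ← Int.toNat_natCast (Rat.den _), hden]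

/-- Adding a multiple of the divisor `v` to the leading coefficient. -/
theorem EuclidDiv.add_mul_left {u v x y q : ℤ} (hy : 0 < y) (hq : v ∣ q)
    (h : EuclidDiv u v x y) : EuclidDiv u v (x + q * y) y := by
  rw [euclidDiv_iff _ _ _ hy] at h ⊢
  rw [Int.add_mul_ediv_right _ _ hy.ne', Int.add_mul_emod_self_right]
  exact ⟨dvd_add h.1 hq, h.2⟩

/-- Adding a multiple of the divisor `u` to the leading coefficient of the reciprocal. -/
theorem EuclidDiv.add_mul_right {u v x y q : ℤ} (hv : 2 ≤ v) (hx : 0 ≤ x) (hy : 0 < y)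
    (hq0 : 0 ≤ q) (hq : u ∣ q) (h : EuclidDiv u v x y) :
    EuclidDiv u v x (y + q * x) := by
  rcases hq0.eq_or_lt with rfl | hq0
  · simpa using h
  rcases hx.eq_or_lt with rfl | hx
  · simpa using h
  have hlt : x < y + q * x := by nlinarith
  rw [euclidDiv_iff _ _ _ (hx.trans hlt), Int.ediv_eq_zero_of_lt hx.le hlt,
    Int.emod_eq_of_lt hx.le hlt]
  refine ⟨dvd_zero v, EuclidDiv.add_mul_left hx hq ?_⟩
  rcases lt_trichotomy x y with hxy | rfl | hxy
  · rw [euclidDiv_iff _ _ _ hy, Int.emod_eq_of_lt hx.le hxy] at h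
    exact h.2
  · rw [euclidDiv_iff _ _ _ hy, Int.ediv_self hy.ne'] at h
    have := Int.le_of_dvd one_pos h.1
    omega
  · rw [euclidDiv_iff _ _ _ hx, Int.ediv_eq_zero_of_lt hy.le hxy,
      Int.emod_eq_of_lt hy.le hxy]
    exact ⟨dvd_zero u, h⟩

/-- Divisibility passes from the first column to the second one. -/
theorem EuclidDiv.second_column {u v : ℤ} (hv : 2 ≤ v) (n : ℕ) :
    ∀ a b c d : ℤ, a ≤ n → 0 < a → 0 ≤ b → 0 ≤ c → a * d - b * c = 1 →
      a ≡ 1 [ZMOD v] → v ∣ b → EuclidDiv v u c a → EuclidDiv u v b d := by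
  induction n with
  | zero => intro a b c d h h'; omega
  | succ n ih =>
    intro a b c d han ha hb hc hdet hav hvb h
    rw [euclidDiv_iff _ _ _ ha] at h
    obtain ⟨hq, h⟩ := h
    have hq0 : 0 ≤ c / a := Int.ediv_nonneg hc ha.le
    have hr0 : 0 ≤ c % a := Int.emod_nonneg c ha.ne'
    have hra : c % a < a := Int.emod_lt_of_pos c ha
    have hcr : c = c % a + c / a * a := by linarith [Int.emod_add_mul_ediv c a]
    generalize c / a = q at *
    generalize c % a = r at *
    obtain ⟨e, rfl⟩ : ∃ e, d = e + q * b := ⟨d - q * b, by ring⟩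
    have hdet' : a * e - b * r = 1 := by rw [hcr] at hdet; linarith
    have he : 0 < e := by
      by_contra! he
      nlinarith [mul_nonneg hb hr0]
    refine EuclidDiv.add_mul_right hv hb he hq0 hq ?_
    rcases hr0.eq_or_lt with rfl | hr
    · have he1 : e = 1 := by
        have : a * e = 1 := by linarith
        exact Int.eq_one_of_mul_eq_one_left he.le this
      subst he1
      rw [euclidDiv_iff _ _ _ one_pos]
      simpa using ⟨hvb, euclidDiv_zero v u 1⟩
    rw [euclidDiv_iff _ _ _ hr] at h
    obtain ⟨hp, h⟩ := h
    have hs0 : 0 ≤ a % r := Int.emod_nonneg a hr.ne'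
    have hsr : a % r < r := Int.emod_lt_of_pos a hr
    have has : a = a % r + a / r * r := by linarith [Int.emod_add_mul_ediv a r]
    generalize a / r = p at *
    generalize a % r = s at *
    obtain ⟨g, rfl⟩ : ∃ g, b = g + p * e := ⟨b - p * e, by ring⟩
    have hdet'' : s * e - g * r = 1 := by rw [has] at hdet'; linarith
    have hs : 0 < s := by
      rcases hs0.eq_or_lt with rfl | hs
      · exfalso
        have hv1 : v ∣ 1 := by
          have hva : v ∣ a := by rw [has, zero_add]; exact hp.mul_right r
          exact (Int.dvd_iff_emod_eq_zero.mpr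
            ((hav.symm.trans (Int.modEq_zero_iff_dvd.mpr hva)) : 1 % v = 0 % v))
        have := Int.le_of_dvd one_pos hv1
        omega
      · exact hs
    have hg : 0 ≤ g := by
      by_contra! hg
      nlinarith
    refine EuclidDiv.add_mul_left he hp
      (ih s g r e (by omega) hs hg hr.le hdet'' ?_ ?_ h)
    · refine Int.ModEq.trans ?_ hav
      rw [has]
      exact (Int.modEq_iff_dvd.mpr (by simpa using hp.mul_right r))
    · exact (dvd_add_left (hp.mul_right e)).mp hvb

/-- Proposition oneFracMon: for integers `u, v ≥ 2` and
`M = [[a,b],[c,d]] ∈ 𝒮_{u,v}`, `C(c/a)` satisfies the `(v,u)`-divisibility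
property if and only if `C(b/d)` satisfies the `(u,v)`-divisibility property. -/
theorem oneFracMon (u v : ℤ) (hu : 2 ≤ u) (hv : 2 ≤ v) (M : SL2Z)
    (hM : M ∈ scrS u v) :
    DivProp v u (C ((M.1 1 0 : ℚ) / (M.1 0 0 : ℚ))) ↔
      DivProp u v (C ((M.1 0 1 : ℚ) / (M.1 1 1 : ℚ))) := by
  obtain ⟨ha, hb, hc, hd, hau, hdu, hvb, huc⟩ := hM
  have hdet := M.2
  rw [Matrix.det_fin_two] at hdet
  generalize M.1 0 0 = a at *
  generalize M.1 0 1 = b at *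
  generalize M.1 1 0 = c at *
  generalize M.1 1 1 = d at *
  have hpos : ∀ x : ℤ, 0 ≤ x → x ≡ 1 [ZMOD u * v] → 0 < x := by
    intro x hx hxu
    refine hx.lt_of_ne ?_
    rintro rfl
    have := Int.le_of_dvd one_pos (by simpa using hxu.dvd)
    nlinarith
  have ha := hpos a ha hau
  have hd := hpos d hd hdu
  rw [C_div_eq ha ⟨-b, d, by linarith⟩, C_div_eq hd ⟨-c, a, by linarith⟩]
  exact ⟨EuclidDiv.second_column hv a.toNat a b c d (by omega) ha hb hc hdet
      (hau.of_mul_left u) hvb,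
    EuclidDiv.second_column hu d.toNat d c b a (by omega) hd hc hb (by linarith)
      (hdu.of_mul_right v) huc⟩
end

section
/- Let u, v ≥ 2 be integers and let M = [[a,b],[c,d]] ∈ 𝒮_{u,v} (so that d ≥ 1). Then M belongs to the monoid S_{u,v} generated by L_u and R_v if and only if C(b/d) satisfies the (u,v)-divisibility property. -/
open Matrix

/-- The divisibility property of the short continued fraction of `b / d`, for `0 < d`. -/
def QuotDivProp (u v b d : ℤ) : Prop := DivProp u v (scfAux b d.toNat)

theorem quotDivProp_iff (u v b : ℤ) {d : ℤ} (hd : 0 < d) :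
    QuotDivProp u v b d ↔ v ∣ b / d ∧ (b % d ≠ 0 → QuotDivProp v u d (b % d)) := by
  have hcast : (d.toNat : ℤ) = d := Int.toNat_of_nonneg hd.le
  have hmod : 0 ≤ b % d := Int.emod_nonneg b hd.ne'
  have hmod' : b.emod d = b % d := rfl
  have hdiv' : b.ediv d = b / d := rfl
  unfold QuotDivProp
  rw [scfAux]
  simp only [hcast, hmod', hdiv']
  rw [dif_neg (by omega)]
  by_cases h : b % d = 0
  · rw [dif_pos (by omega), divProp_cons]
    simp [h, DivProp]
  · rw [dif_neg (by omega), divProp_cons]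
    simp [h]

theorem quotDivProp_add_mul (u v b : ℤ) {d : ℤ} (hd : 0 < d) :
    QuotDivProp u v (b + v * d) d ↔ QuotDivProp u v b d := by
  rw [quotDivProp_iff u v _ hd, quotDivProp_iff u v b hd, Int.add_mul_ediv_right _ _ hd.ne',
    Int.add_mul_emod_self_right, dvd_add_self_right]

theorem quotDivProp_swap_of_lt (u v : ℤ) {b d : ℤ} (hb : 0 < b) (hbd : b < d) :
    QuotDivProp u v b d ↔ QuotDivProp v u d b := by
  rw [quotDivProp_iff u v b (hb.trans hbd), Int.ediv_eq_zero_of_lt hb.le hbd,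
    Int.emod_eq_of_lt hb.le hbd]
  simp [hb.ne']

theorem quotDivProp_swap (u v : ℤ) {b d : ℤ} (hb : 0 < b) (hd : 0 < d) (hbd : b ≠ d) :
    QuotDivProp u v b d ↔ QuotDivProp v u d b := by
  rcases hbd.lt_or_gt with h | h
  · exact quotDivProp_swap_of_lt u v hb h
  · exact (quotDivProp_swap_of_lt v u hd h).symm

theorem quotDivProp_zero_left (u v : ℤ) {d : ℤ} (hd : 0 < d) : QuotDivProp u v 0 d := by
  simp [quotDivProp_iff u v 0 hd]

/-- If `v ∣ b` and `d ≡ 1 (mod v)` then `b ≠ d`. -/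
theorem ne_of_dvd_of_dvd_sub_one {v b d : ℤ} (hv : 2 ≤ v) (hb : v ∣ b) (hd : v ∣ d - 1) :
    b ≠ d := by
  rintro rfl
  have h := dvd_sub hb hd
  rw [sub_sub_cancel] at h
  have := Int.le_of_dvd one_pos h
  omega

theorem le_of_dvd_ediv {v b d : ℤ} (hd : 0 < d) (hbd : d ≤ b) (h : v ∣ b / d) : v * d ≤ b := by
  have hq : 0 < b / d := Int.lt_of_lt_of_le one_pos ((Int.le_ediv_iff_mul_le hd).2 (by omega))
  exact (Int.le_ediv_iff_mul_le hd).1 (Int.le_of_dvd hq h)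

theorem Lmat_mul_coe (u : ℤ) (M : SL2Z) :
    (Lmat u * M).1 = !![M.1 0 0, M.1 0 1; M.1 1 0 + u * M.1 0 0, M.1 1 1 + u * M.1 0 1] := by
  rw [Matrix.SpecialLinearGroup.coe_mul]
  ext i j
  fin_cases i <;> fin_cases j <;> simp [Lmat, Matrix.mul_apply, Fin.sum_univ_two, add_comm]

theorem Rmat_mul_coe (v : ℤ) (M : SL2Z) :
    (Rmat v * M).1 = !![M.1 0 0 + v * M.1 1 0, M.1 0 1 + v * M.1 1 1; M.1 1 0, M.1 1 1] := by
  rw [Matrix.SpecialLinearGroup.coe_mul]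
  ext i j
  fin_cases i <;> fin_cases j <;> simp [Rmat, Matrix.mul_apply, Fin.sum_univ_two]

theorem quotDivProp_of_mem_Smonoid {u v : ℤ} (hu : 2 ≤ u) (hv : 2 ≤ v) {M : SL2Z}
    (hM : M ∈ Smonoid u v) :
    0 ≤ M.1 0 1 ∧ 0 < M.1 1 1 ∧ v ∣ M.1 0 1 ∧ v ∣ M.1 1 1 - 1 ∧
      QuotDivProp u v (M.1 0 1) (M.1 1 1) := by
  induction hM using Submonoid.closure_induction_left with
  | one => simpa using quotDivProp_zero_left u v one_pos
  | mul_left x hx M _ ih =>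
    obtain ⟨hb, hd, hvb, hvd, hq⟩ := ih
    rcases hx with rfl | rfl
    · simp only [Lmat_mul_coe, Matrix.of_apply, Matrix.cons_val]
      generalize M.1 0 1 = b at *
      generalize M.1 1 1 = d at *
      have hd' : 0 < d + u * b := by positivity
      have hvd' : v ∣ d + u * b - 1 := by
        rw [add_sub_right_comm]
        exact dvd_add hvd (hvb.mul_left u)
      refine ⟨hb, hd', hvb, hvd', ?_⟩
      rcases hb.eq_or_lt with rfl | hb
      · exact quotDivProp_zero_left u v hd'
      · rw [quotDivProp_swap u v hb hd' (ne_of_dvd_of_dvd_sub_one hv hvb hvd'),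
          quotDivProp_add_mul v u d hb,
          ← quotDivProp_swap u v hb hd (ne_of_dvd_of_dvd_sub_one hv hvb hvd)]
        exact hq
    · simp only [Rmat_mul_coe, Matrix.of_apply, Matrix.cons_val]
      exact ⟨by positivity, hd, dvd_add hvb (dvd_mul_right _ _), hvd,
        (quotDivProp_add_mul u v _ hd).2 hq⟩

theorem det_eq_one (M : SL2Z) : M.1 0 0 * M.1 1 1 - M.1 0 1 * M.1 1 0 = 1 := by
  rw [← Matrix.det_fin_two]
  exact M.2

theorem pos_of_modEq_one {u v a : ℤ} (hu : 2 ≤ u) (hv : 2 ≤ v) (ha : 0 ≤ a)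
    (h : a ≡ 1 [ZMOD (u * v)]) : 0 < a := by
  rcases ha.eq_or_lt with rfl | ha
  · have := Int.le_of_dvd one_pos (by simpa using h.dvd)
    nlinarith
  · exact ha

theorem Lmat_mem (u v : ℤ) : Lmat u ∈ Smonoid u v := Submonoid.subset_closure (by simp)

theorem Rmat_mem (u v : ℤ) : Rmat v ∈ Smonoid u v := Submonoid.subset_closure (by simp)

theorem Lmat_pow (u : ℤ) (k : ℕ) : (Lmat u ^ k).1 = !![1, 0; u * k, 1] := by
  induction k with
  | zero =>
    ext i j
    fin_cases i <;> fin_cases j <;> simp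
  | succ k ih =>
    rw [pow_succ, Matrix.SpecialLinearGroup.coe_mul, ih]
    ext i j
    fin_cases i <;> fin_cases j <;> simp [Lmat]
    ring

theorem mem_Smonoid_of_upper_right_eq_zero {u v : ℤ} (hu : 2 ≤ u) {M : SL2Z}
    (hM : M ∈ scrS u v) (hb : M.1 0 1 = 0) : M ∈ Smonoid u v := by
  obtain ⟨ha, -, hc, hd, -, -, -, k, hk⟩ := hM
  have hdet := det_eq_one M
  rw [hb, zero_mul, sub_zero] at hdet
  have ha1 : M.1 0 0 = 1 := Int.eq_one_of_mul_eq_one_right ha hdet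
  have hd1 : M.1 1 1 = 1 := by rwa [ha1, one_mul] at hdet
  have hk0 : 0 ≤ k := by
    rw [hk] at hc
    exact nonneg_of_mul_nonneg_right hc (by omega)
  lift k to ℕ using hk0
  have : M = Lmat u ^ k := by
    apply Subtype.ext
    rw [Lmat_pow, Matrix.eta_fin_two M.1, ha1, hb, hk, hd1]
  rw [this]
  exact pow_mem (Lmat_mem u v) k

theorem mem_Smonoid_of_quotDivProp {u v : ℤ} (hu : 2 ≤ u) (hv : 2 ≤ v) {M : SL2Z}
    (hM : M ∈ scrS u v) (hq : QuotDivProp u v (M.1 0 1) (M.1 1 1)) : M ∈ Smonoid u v := by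
  induction hn : (M.1 0 1 + M.1 1 1).toNat using Nat.strong_induction_on generalizing M with
  | _ n ih =>
  obtain ⟨ha, hb, hc, hd, hma, hmd, hvb, huc⟩ := id hM
  replace ha := pos_of_modEq_one hu hv ha hma
  replace hd := pos_of_modEq_one hu hv hd hmd
  rcases hb.eq_or_lt with hb | hb
  · exact mem_Smonoid_of_upper_right_eq_zero hu hM hb.symm
  have hvd : v ∣ M.1 1 1 - 1 := (dvd_mul_left v u).trans hmd.symm.dvd
  have hne := ne_of_dvd_of_dvd_sub_one hv hvb hvd
  rcases hne.lt_or_gt with hlt | hlt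
  · -- peel off a factor `Lmat u`
    have hq' := (quotDivProp_swap u v hb hd hne).1 hq
    have hle := le_of_dvd_ediv hb hlt.le ((quotDivProp_iff v u _ hb).1 hq').1
    obtain ⟨N, hMN⟩ : ∃ N, M = Lmat u * N :=
      ⟨(Lmat u)⁻¹ * M, (mul_inv_cancel_left _ _).symm⟩
    have h00 : N.1 0 0 = M.1 0 0 := by
      simp [hMN, Lmat_mul_coe, -Matrix.SpecialLinearGroup.coe_mul]
    have h01 : N.1 0 1 = M.1 0 1 := by
      simp [hMN, Lmat_mul_coe, -Matrix.SpecialLinearGroup.coe_mul]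
    have h10 : N.1 1 0 = M.1 1 0 - u * M.1 0 0 := by
      simp [hMN, Lmat_mul_coe, -Matrix.SpecialLinearGroup.coe_mul]
    have h11 : N.1 1 1 = M.1 1 1 - u * M.1 0 1 := by
      simp [hMN, Lmat_mul_coe, -Matrix.SpecialLinearGroup.coe_mul]
    have hmd' : N.1 1 1 ≡ 1 [ZMOD (u * v)] := by
      rw [h11]
      have := hmd.sub (Int.modEq_zero_iff_dvd.2 (mul_dvd_mul_left u hvb))
      simpa using this
    have hd' : 0 < N.1 1 1 := pos_of_modEq_one hu hv (by omega) hmd'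
    have hdet' := det_eq_one N
    have hc' : 0 ≤ N.1 1 0 := by
      rw [h00, h01] at hdet'
      by_contra hneg
      nlinarith [mul_pos ha hd']
    rw [hMN]
    refine mul_mem (Lmat_mem u v) (ih _ ?_ ?_ ?_ rfl)
    · rw [h01, h11]
      have : 0 < u * M.1 0 1 := by positivity
      omega
    · refine ⟨h00 ▸ ha.le, h01 ▸ hb.le, hc', hd'.le, h00 ▸ hma, hmd', h01 ▸ hvb, ?_⟩
      rw [h10]
      exact dvd_sub huc (dvd_mul_right _ _)
    · have hvd' : v ∣ N.1 1 1 - 1 := (dvd_mul_left v u).trans hmd'.symm.dvd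
      have hb' : 0 < N.1 0 1 := h01 ▸ hb
      rw [quotDivProp_swap u v hb' hd' (ne_of_dvd_of_dvd_sub_one hv (h01 ▸ hvb) hvd'),
        ← quotDivProp_add_mul v u _ hb', h11, h01, sub_add_cancel]
      exact hq'
  · -- peel off a factor `Rmat v`
    have hle := le_of_dvd_ediv hd hlt.le ((quotDivProp_iff u v _ hd).1 hq).1
    obtain ⟨N, hMN⟩ : ∃ N, M = Rmat v * N :=
      ⟨(Rmat v)⁻¹ * M, (mul_inv_cancel_left _ _).symm⟩
    have h00 : N.1 0 0 = M.1 0 0 - v * M.1 1 0 := by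
      simp [hMN, Rmat_mul_coe, -Matrix.SpecialLinearGroup.coe_mul]
    have h01 : N.1 0 1 = M.1 0 1 - v * M.1 1 1 := by
      simp [hMN, Rmat_mul_coe, -Matrix.SpecialLinearGroup.coe_mul]
    have h10 : N.1 1 0 = M.1 1 0 := by
      simp [hMN, Rmat_mul_coe, -Matrix.SpecialLinearGroup.coe_mul]
    have h11 : N.1 1 1 = M.1 1 1 := by
      simp [hMN, Rmat_mul_coe, -Matrix.SpecialLinearGroup.coe_mul]
    have hma' : N.1 0 0 ≡ 1 [ZMOD (u * v)] := by
      rw [h00]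
      have := hma.sub (Int.modEq_zero_iff_dvd.2
        (mul_comm v u ▸ mul_dvd_mul_left v huc : u * v ∣ v * M.1 1 0))
      simpa using this
    have hb' : 0 ≤ N.1 0 1 := by omega
    have hdet' := det_eq_one N
    have ha' : 0 ≤ N.1 0 0 := by
      rw [h10, h11] at hdet'
      by_contra hneg
      nlinarith [mul_nonneg hb' hc]
    rw [hMN]
    refine mul_mem (Rmat_mem u v) (ih _ ?_ ?_ ?_ rfl)
    · rw [h01, h11]
      have : 0 < v * M.1 1 1 := by positivity
      omega
    · refine ⟨ha', hb', h10 ▸ hc, h11 ▸ hd.le, hma', h11 ▸ hmd, ?_, h10 ▸ huc⟩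
      rw [h01]
      exact dvd_sub hvb (dvd_mul_right _ _)
    · rw [← quotDivProp_add_mul u v _ (h11 ▸ hd), h11, h01, sub_add_cancel]
      exact hq

theorem divProp_C_div_iff (u v : ℤ) {b d : ℤ} (hd : 0 < d) (h : IsCoprime b d) :
    DivProp u v (C ((b : ℚ) / (d : ℚ))) ↔ QuotDivProp u v b d := by
  have hcop : Nat.Coprime b.natAbs d.natAbs := Int.isCoprime_iff_gcd_eq_one.1 h
  have hden : ((b : ℚ) / (d : ℚ)).den = d.toNat := by
    have := Rat.den_div_eq_of_coprime hd hcop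
    omega
  rw [C, Rat.num_div_eq_of_coprime hd hcop, hden, QuotDivProp]

/-- Theorem sanovlike: for integers `u, v ≥ 2` and
`M = [[a,b],[c,d]] ∈ 𝒮_{u,v}`, `M` belongs to the monoid `S_{u,v}` generated by
`L_u` and `R_v` if and only if `C(b/d)` satisfies the `(u,v)`-divisibility
property. -/
theorem sanovlike (u v : ℤ) (hu : 2 ≤ u) (hv : 2 ≤ v) (M : SL2Z)
    (hM : M ∈ scrS u v) :
    M ∈ Smonoid u v ↔ DivProp u v (C ((M.1 0 1 : ℚ) / (M.1 1 1 : ℚ))) := by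
  have hd : 0 < M.1 1 1 := pos_of_modEq_one hu hv hM.2.2.2.1 hM.2.2.2.2.2.1
  have hcop : IsCoprime (M.1 0 1) (M.1 1 1) :=
    ⟨-M.1 1 0, M.1 0 0, by linear_combination det_eq_one M⟩
  rw [divProp_C_div_iff u v hd hcop]
  exact ⟨fun h => (quotDivProp_of_mem_Smonoid hu hv h).2.2.2.2,
    mem_Smonoid_of_quotDivProp hu hv hM⟩
end
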